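/- arXiv:0802.1052 — 2 statements merged into one kernel-verified Lean document; each statement's English description precedes it below -/
import Mathlib

section
/- Let R be a set of nonnegative integers admitting a Diophantine representation: there exist δ ≥ 1 and a polynomial R₀ with integer coefficients in δ+1 variables such that for all nonnegative integers a, a ∈ R if and only if there exist nonnegative integers h₁,…,h_δ with R₀(a,h₁,…,h_δ) = 0. Then there exist a positive integer ε and polynomials with integer coefficients P₁,…,P_ε, D₁,…,D_ε, Q₁,…,Q_ε in three variables such that for every nonnegative integer a, a ∈ R if and only if there exist nonnegative integers b and c such that for every ι with 1 ≤ ι ≤ ε there exists a nonnegative integer d with P_ι(a,b,c) < D_ι(a,b,c)·d < Q_ι(a,b,c). -/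
open MvPolynomial

/-- The conjuncts of the target form: a multiple of `t.2.1` lies strictly between `t.1` and
`t.2.2`. -/
def HasMultipleBetween
    (t : MvPolynomial (Fin 3) ℤ × MvPolynomial (Fin 3) ℤ × MvPolynomial (Fin 3) ℤ)
    (a b c : ℕ) : Prop :=
  ∃ d : ℕ, eval ![(a : ℤ), (b : ℤ), (c : ℤ)] t.1 <
      eval ![(a : ℤ), (b : ℤ), (c : ℤ)] t.2.1 * (d : ℤ) ∧
    eval ![(a : ℤ), (b : ℤ), (c : ℤ)] t.2.1 * (d : ℤ) <
      eval ![(a : ℤ), (b : ℤ), (c : ℤ)] t.2.2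

/-- Ternary relations that are finite conjunctions of conditions `HasMultipleBetween t`. -/
def IsMultipleSystem (S : ℕ → ℕ → ℕ → Prop) : Prop :=
  ∃ l : List (MvPolynomial (Fin 3) ℤ × MvPolynomial (Fin 3) ℤ × MvPolynomial (Fin 3) ℤ),
    ∀ a b c, S a b c ↔ ∀ t ∈ l, HasMultipleBetween t a b c

namespace IsMultipleSystem

theorem and {S T : ℕ → ℕ → ℕ → Prop} (hS : IsMultipleSystem S) (hT : IsMultipleSystem T) :
    IsMultipleSystem fun a b c => S a b c ∧ T a b c := by
  obtain ⟨l, hl⟩ := hS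
  obtain ⟨m, hm⟩ := hT
  refine ⟨l ++ m, fun a b c => ?_⟩
  simp only [hl, hm, List.forall_mem_append]

theorem forall_lt (n : ℕ) {S : ℕ → ℕ → ℕ → ℕ → Prop} (hS : ∀ j, IsMultipleSystem (S j)) :
    IsMultipleSystem fun a b c => ∀ j < n, S j a b c := by
  choose l hl using hS
  refine ⟨(List.range n).flatMap l, fun a b c => ?_⟩
  simp only [hl, List.mem_flatMap, List.mem_range]
  exact ⟨fun h t ⟨j, hj, ht⟩ => h j hj t ht, fun h j hj t ht => h t ⟨j, hj, ht⟩⟩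

theorem pos (q : MvPolynomial (Fin 3) ℤ) :
    IsMultipleSystem fun a b c => 0 < eval ![(a : ℤ), (b : ℤ), (c : ℤ)] q := by
  refine ⟨[(-1, 0, q)], fun a b c => ?_⟩
  simp [HasMultipleBetween]

theorem mod_pow_lt (r s : ℕ) : IsMultipleSystem fun _ b c => c % b ^ r < b ^ s := by
  refine ⟨[(X 2 - X 1 ^ s, X 1 ^ r, X 2 + 1)], fun a b c => ?_⟩
  simp only [List.mem_singleton, forall_eq, HasMultipleBetween, map_sub, map_add, map_pow, eval_X,
    map_one, Matrix.cons_val]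
  have hcast (d : ℕ) : (c : ℤ) - (b : ℤ) ^ s < (b : ℤ) ^ r * d ∧ (b : ℤ) ^ r * d < (c : ℤ) + 1 ↔
      c < b ^ r * d + b ^ s ∧ b ^ r * d ≤ c := by
    rw [sub_lt_iff_lt_add, Int.lt_add_one_iff]
    norm_cast
  simp only [hcast]
  constructor
  · intro h
    refine ⟨c / b ^ r, ?_, Nat.mul_div_le _ _⟩
    have := Nat.div_add_mod c (b ^ r)
    omega
  · rintro ⟨d, h1, h2⟩
    obtain ⟨e, rfl⟩ := Nat.exists_eq_add_of_le h2
    rw [Nat.mul_add_mod]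
    exact (Nat.mod_le _ _).trans_lt (by omega)

theorem abs_sub_lt (g : MvPolynomial (Fin 3) ℤ) {r s : ℕ} (hsr : s ≤ r) :
    IsMultipleSystem fun a b c => 0 < b ∧ ∃ d : ℤ,
      |2 * eval ![(a : ℤ), (b : ℤ), (c : ℤ)] g - 2 * (b : ℤ) ^ r * d| < (b : ℤ) ^ s := by
  refine ⟨[(-1, 0, X 1), (2 * (g + X 1 ^ r * g ^ 2) - X 1 ^ s, 2 * X 1 ^ r,
    2 * (g + X 1 ^ r * g ^ 2) + X 1 ^ s)], fun a b c => ?_⟩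
  simp only [List.forall_mem_cons, HasMultipleBetween, map_sub, map_add, map_pow, eval_X, map_mul,
    map_one, map_neg, map_zero, map_ofNat, Matrix.cons_val, zero_mul, List.not_mem_nil,
    IsEmpty.forall_iff, implies_true, and_true, exists_const]
  generalize eval ![(a : ℤ), (b : ℤ), (c : ℤ)] g = x
  have hiff : ((0 : ℤ) < b) ↔ 0 < b := Nat.cast_pos
  simp only [hiff, neg_lt_zero, zero_lt_one, true_and]
  refine and_congr_right fun hb => ?_
  have hr : (b : ℤ) ^ s ≤ (b : ℤ) ^ r := pow_le_pow_right₀ (by exact_mod_cast hb) hsr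
  have hs : (0 : ℤ) < (b : ℤ) ^ s := by positivity
  constructor
  · rintro ⟨d, hd⟩
    rw [abs_lt] at hd
    have hx : 0 ≤ x + (b : ℤ) ^ r * x ^ 2 := by
      have h1 : 0 ≤ x + x ^ 2 := by
        rcases le_or_gt 0 x with h | h <;> nlinarith
      nlinarith [sq_nonneg x]
    have hd0 : 0 ≤ d + x ^ 2 := by
      by_contra! h
      nlinarith
    refine ⟨(d + x ^ 2).toNat, ?_, ?_⟩ <;> rw [Int.toNat_of_nonneg hd0] <;> nlinarith
  · rintro ⟨d, h1, h2⟩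
    refine ⟨d - x ^ 2, ?_⟩
    rw [abs_lt]
    constructor <;> nlinarith

/-- Repackaging of a system as families indexed by `Fin ε` with `ε` positive. -/
theorem exists_fin {S : ℕ → ℕ → ℕ → Prop} (hS : IsMultipleSystem S) :
    ∃ ε : ℕ, 0 < ε ∧ ∃ P D Q : Fin ε → MvPolynomial (Fin 3) ℤ,
      ∀ a b c, S a b c ↔ ∀ i, HasMultipleBetween (P i, D i, Q i) a b c := by
  obtain ⟨l, hl⟩ := (pos 1).and hS
  simp only [map_one, zero_lt_one, true_and] at hl
  refine ⟨((-1, 0, 1) :: l).length, by simp, fun i => (((-1, 0, 1) :: l).get i).1,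
    fun i => (((-1, 0, 1) :: l).get i).2.1, fun i => (((-1, 0, 1) :: l).get i).2.2,
    fun a b c => ?_⟩
  have h : HasMultipleBetween (-1, 0, 1) a b c := by simp [HasMultipleBetween]
  have hcons := List.forall_mem_cons (p := fun t => HasMultipleBetween t a b c) (a := (-1, 0, 1))
    (l := l)
  rw [hl, ← and_iff_right (b := ∀ t ∈ l, _) h, ← hcons]
  exact List.forall_mem_iff_get

end IsMultipleSystem

/-- For `B` large compared to the coefficients, the total coefficient of `B ^ s` in a sum of
multiples of powers of `B` vanishes iff the sum is close to a multiple of `B ^ (s + 1)`. -/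
theorem sum_coeff_eq_zero_iff {ι : Type*} (T : Finset ι) (u : ι → ℤ) (p : ι → ℕ) (B : ℤ) (s : ℕ)
    (hB : 4 * ∑ t ∈ T, |u t| < B) :
    ∑ t ∈ T with p t = s, u t = 0 ↔
      ∃ d : ℤ, |2 * ∑ t ∈ T, u t * B ^ p t - 2 * B ^ (s + 1) * d| < B ^ s := by
  have hU : 0 ≤ ∑ t ∈ T, |u t| := Finset.sum_nonneg fun _ _ => abs_nonneg _
  have hB0 : 0 < B := by linarith
  have hBs : 0 < B ^ s := pow_pos hB0 s
  set V := ∑ t ∈ T with p t = s, u t with hV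
  set low := ∑ t ∈ T with p t < s, u t * B ^ p t with hlow
  obtain ⟨H, hH⟩ : B ^ (s + 1) ∣ ∑ t ∈ T with s < p t, u t * B ^ p t :=
    Finset.dvd_sum fun t ht =>
      (pow_dvd_pow B (Finset.mem_filter.mp ht).2).mul_left _
  have hsplit : ∑ t ∈ T, u t * B ^ p t = low + V * B ^ s + B ^ (s + 1) * H := by
    rw [← hH, hlow, hV, Finset.sum_mul, Finset.sum_filter, Finset.sum_filter, Finset.sum_filter,
      ← Finset.sum_add_distrib, ← Finset.sum_add_distrib]
    refine Finset.sum_congr rfl fun t _ => ?_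
    rcases lt_trichotomy (p t) s with h | h | h
    · simp [h, h.ne, h.not_gt]
    · simp [h]
    · simp [h, h.ne', h.not_gt]
  have hlow4 : 4 * |low| < B ^ s := by
    have h1 : |low| * B ≤ (∑ t ∈ T, |u t|) * B ^ s := by
      calc |low| * B ≤ (∑ t ∈ T with p t < s, |u t * B ^ p t|) * B := by
            gcongr
            exact Finset.abs_sum_le_sum_abs _ _
        _ = ∑ t ∈ T with p t < s, |u t| * B ^ (p t + 1) := by
            rw [Finset.sum_mul]
            refine Finset.sum_congr rfl fun t _ => ?_
            rw [abs_mul, abs_of_pos (pow_pos hB0 _)]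
            ring
        _ ≤ ∑ t ∈ T with p t < s, |u t| * B ^ s := by
            refine Finset.sum_le_sum fun t ht => ?_
            gcongr
            exact (Finset.mem_filter.mp ht).2
        _ ≤ ∑ t ∈ T, |u t| * B ^ s :=
            Finset.sum_le_sum_of_subset_of_nonneg (Finset.filter_subset _ _)
              fun t _ _ => by positivity
        _ = _ := (Finset.sum_mul _ _ _).symm
    refine lt_of_mul_lt_mul_right ?_ hB0.le
    nlinarith
  have hVB : 4 * |V| < B := by
    refine lt_of_le_of_lt ?_ hB
    gcongr
    exact (Finset.abs_sum_le_sum_abs _ _).trans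
      (Finset.sum_le_sum_of_subset_of_nonneg (Finset.filter_subset _ _) fun _ _ _ => abs_nonneg _)
  rw [hsplit]
  have hl := abs_lt.mp (show |low| < B ^ s by linarith [abs_nonneg low])
  constructor
  · intro h0
    refine ⟨H, ?_⟩
    rw [h0, show 2 * (low + 0 * B ^ s + B ^ (s + 1) * H) - 2 * B ^ (s + 1) * H = 2 * low by ring,
      abs_mul, abs_two]
    linarith [abs_nonneg low]
  · rintro ⟨d, hd⟩
    have hdvd : B ∣ V := by
      refine ⟨d - H, ?_⟩
      have h2 : |B ^ s * (V - B * (d - H))| < B ^ s * 1 := by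
        rw [show B ^ s * (V - B * (d - H)) =
          (low + V * B ^ s + B ^ (s + 1) * H - B ^ (s + 1) * d) - low by ring]
        have h3 := abs_sub (low + V * B ^ s + B ^ (s + 1) * H - B ^ (s + 1) * d) low
        rw [show 2 * (low + V * B ^ s + B ^ (s + 1) * H) - 2 * B ^ (s + 1) * d =
          2 * (low + V * B ^ s + B ^ (s + 1) * H - B ^ (s + 1) * d) by ring, abs_mul, abs_two] at hd
        linarith
      rw [abs_mul, abs_of_pos hBs] at h2
      exact sub_eq_zero.mp (Int.abs_lt_one_iff.mp (lt_of_mul_lt_mul_left h2 hBs.le))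
    exact Int.eq_zero_of_abs_lt_dvd hdvd (by linarith [abs_nonneg V])

/-- Partial sums of a sparse base-`b` expansion with digits below `b`. -/
theorem sum_digits_lt {b : ℕ} (hb : 0 < b) {s : ℕ → ℕ} (hs : StrictMono s) {h : ℕ → ℕ} {n : ℕ}
    (hh : ∀ j < n, h j < b) : ∑ j ∈ Finset.range n, h j * b ^ s j < b ^ s n := by
  induction n with
  | zero => simpa using pow_pos hb _
  | succ n ih =>
    rw [Finset.sum_range_succ]
    have h1 := ih fun j hj => hh j (hj.trans n.lt_succ_self)
    calc _ < b ^ s n + h n * b ^ s n := by gcongr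
      _ = (h n + 1) * b ^ s n := by ring
      _ ≤ b * b ^ s n := by gcongr; exact hh n n.lt_succ_self
      _ = b ^ (s n + 1) := by ring
      _ ≤ b ^ s (n + 1) := Nat.pow_le_pow_right hb (hs n.lt_succ_self)

/-- Characterisation of the sums `∑ j < n, h j * b ^ s j` with all `h j < b` by remainders. -/
theorem exists_digits_iff {b : ℕ} (hb : 0 < b) {s : ℕ → ℕ} (hs : StrictMono s) {n c : ℕ} :
    (c % b ^ s 0 < b ^ 0 ∧ (∀ j < n, c % b ^ s (j + 1) < b ^ (s j + 1)) ∧ c < b ^ s n) ↔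
      ∃ h : ℕ → ℕ, (∀ j < n, h j < b) ∧ c = ∑ j ∈ Finset.range n, h j * b ^ s j := by
  constructor
  · rintro ⟨h0, h1, h2⟩
    refine ⟨fun j => c % b ^ s (j + 1) / b ^ s j, fun j hj => ?_, ?_⟩
    · exact Nat.div_lt_of_lt_mul (by simpa [pow_succ] using h1 j hj)
    · conv_lhs => rw [← Nat.mod_eq_of_lt h2]
      clear h1 h2
      induction n with
      | zero => simpa using h0
      | succ n ih =>
        rw [Finset.sum_range_succ, ← ih, ← Nat.mod_mod_of_dvd c
          (pow_dvd_pow b (hs.monotone n.le_succ))]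
        exact (Nat.mod_add_div' _ _).symm
  · rintro ⟨h, hh, hc⟩
    have hmod (m : ℕ) (hm : m ≤ n) : c % b ^ s m = ∑ j ∈ Finset.range m, h j * b ^ s j := by
      obtain ⟨k, rfl⟩ := Nat.exists_eq_add_of_le hm
      obtain ⟨q, hq⟩ : b ^ s m ∣ ∑ j ∈ Finset.range k, h (m + j) * b ^ s (m + j) :=
        Finset.dvd_sum fun j _ => (pow_dvd_pow b (hs.monotone (Nat.le_add_right m j))).mul_left _
      rw [hc, Finset.sum_range_add, hq, Nat.add_mul_mod_self_left]
      exact Nat.mod_eq_of_lt (sum_digits_lt hb hs fun j hj => hh j (hj.trans_le hm))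
    refine ⟨by simp [hmod 0 n.zero_le], fun j hj => ?_, hc ▸ sum_digits_lt hb hs hh⟩
    rw [hmod (j + 1) hj, Finset.sum_range_succ, pow_succ]
    have h1 := sum_digits_lt hb hs fun i hi => hh i (hi.trans hj)
    have h2 := Nat.mul_le_mul_right (b ^ s j) (hh j hj)
    linarith [Nat.succ_mul (h j) (b ^ s j)]

/-- Uniqueness of digits. -/
theorem eq_of_sum_mul_pow_eq {M n : ℕ} {k l : Fin n → ℕ} (hk : ∀ i, k i < M) (hl : ∀ i, l i < M)
    (h : ∑ i, k i * M ^ (i : ℕ) = ∑ i, l i * M ^ (i : ℕ)) : k = l := by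
  induction n with
  | zero => exact Subsingleton.elim _ _
  | succ n ih =>
    have key (f : Fin (n + 1) → ℕ) : ∑ i, f i * M ^ (i : ℕ) =
        f 0 + M * ∑ i : Fin n, f i.succ * M ^ (i : ℕ) := by
      rw [Fin.sum_univ_succ, Finset.mul_sum]
      simp only [Fin.val_zero, pow_zero, mul_one, Fin.val_succ, pow_succ]
      congr 1
      exact Finset.sum_congr rfl fun i _ => by ring
    rw [key, key] at h
    have h0 : k 0 = l 0 := by
      have := congrArg (· % M) h
      simpa [Nat.mod_eq_of_lt (hk 0), Nat.mod_eq_of_lt (hl 0)] using this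
    have hM : 0 < M := (Nat.zero_le _).trans_lt (hk 0)
    have h1 := ih (fun i => hk i.succ) (fun i => hl i.succ)
      (Nat.eq_of_mul_eq_mul_left hM (by omega))
    funext i
    exact Fin.cases h0 (fun j => congrFun h1 j) i

/-- The vanishing of `p` at a point `x` with coordinates in `[0, b]` can be read off from a sparse
base-`B` expansion with digits `x i`: the polynomial `g` is arranged so that the total coefficient
of `B ^ s` in `g (B, ∑ i, x i * B ^ e i)` is a positive multiple of `p x`. -/
theorem exists_poly_eval_eq_zero_iff {n : ℕ} (p : MvPolynomial (Fin n) ℤ) (e : Fin n → ℕ)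
    (he : ∀ k l : Fin n → ℕ, (∀ i, k i ≤ p.totalDegree) → (∀ i, l i ≤ p.totalDegree) →
      ∑ i, k i * e i = ∑ i, l i * e i → k = l) :
    ∃ (g : MvPolynomial (Fin 2) ℤ) (s A : ℕ), ∀ (x : Fin n → ℤ) (b B : ℤ), 0 < b →
      (∀ i, 0 ≤ x i) → (∀ i, x i ≤ b) → 4 * (A * b ^ p.totalDegree) < B →
      (eval x p = 0 ↔
        ∃ d : ℤ, |2 * eval ![B, ∑ i, x i * B ^ e i] g - 2 * B ^ (s + 1) * d| < B ^ s) := by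
  classical
  set D := p.totalDegree with hD
  let code (k : Fin n → ℕ) : ℕ := ∑ i, k i * e i
  let size (k : Fin n → ℕ) : ℕ := ∑ i, k i
  let mult (k : Fin n → ℕ) : ℤ := (Nat.multinomial Finset.univ k : ℕ)
  let w (m : Fin n →₀ ℕ) : ℤ := ∏ m' ∈ p.support.erase m, mult m'
  let s : ℕ := ∑ m ∈ p.support, code m
  let A : ℕ := (∑ m ∈ p.support, |p.coeff m * w m|).toNat * (n + 1) ^ D
  let g : MvPolynomial (Fin 2) ℤ :=
    ∑ m ∈ p.support, C (p.coeff m * w m) * X 0 ^ (s - code m) * X 1 ^ size m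
  have hcode {m} (hm : m ∈ p.support) : code m ≤ s :=
    Finset.single_le_sum (f := fun m : Fin n →₀ ℕ => code m) (fun _ _ => Nat.zero_le _) hm
  have hsize {m} (hm : m ∈ p.support) : size m ≤ D := by
    have := le_totalDegree hm
    rwa [Finsupp.sum_fintype _ _ fun _ => rfl] at this
  have hle {k : Fin n → ℕ} (hk : size k ≤ D) (i : Fin n) : k i ≤ D :=
    (Finset.single_le_sum (fun _ _ => Nat.zero_le _) (Finset.mem_univ i)).trans hk
  have hmult (k : Fin n → ℕ) : 0 < mult k := by
    exact Int.natCast_pos.mpr (Nat.multinomial_pos _ _)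
  refine ⟨g, s, A, fun x b B hb hx hxb hB => ?_⟩
  let T : Finset ((_ : Fin n →₀ ℕ) × (Fin n → ℕ)) :=
    p.support.sigma fun m => Finset.piAntidiag Finset.univ (size m)
  let u (t : (_ : Fin n →₀ ℕ) × (Fin n → ℕ)) : ℤ :=
    p.coeff t.1 * w t.1 * (mult t.2 * ∏ i, x i ^ t.2 i)
  let pos (t : (_ : Fin n →₀ ℕ) × (Fin n → ℕ)) : ℕ := s - code t.1 + code t.2
  have hg : eval ![B, ∑ i, x i * B ^ e i] g = ∑ t ∈ T, u t * B ^ pos t := by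
    rw [Finset.sum_sigma]
    simp only [g, map_sum, map_mul, map_pow, eval_C, eval_X, Matrix.cons_val]
    refine Finset.sum_congr rfl fun m _ => ?_
    rw [Finset.sum_pow_eq_sum_piAntidiag, Finset.mul_sum]
    refine Finset.sum_congr rfl fun k _ => ?_
    simp only [u, pos, code, mult, mul_pow, Finset.prod_mul_distrib, pow_add, ← pow_mul,
      Finset.prod_pow_eq_pow_sum]
    rw [Finset.sum_congr rfl fun i _ => mul_comm (e i) (k i)]
    ring
  have hV : ∑ t ∈ T with pos t = s, u t = (∏ m ∈ p.support, mult m) * eval x p := by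
    rw [Finset.sum_filter, Finset.sum_sigma, eval_eq', Finset.mul_sum]
    refine Finset.sum_congr rfl fun m hm => ?_
    rw [Finset.sum_eq_single (m : Fin n → ℕ)]
    · have h1 : pos ⟨m, m⟩ = s := Nat.sub_add_cancel (hcode hm)
      rw [if_pos h1, ← Finset.mul_prod_erase _ _ hm]
      simp only [u, w]
      ring
    · intro k hk hkm
      rw [if_neg]
      intro h
      have hk' : size k = size m := (Finset.mem_piAntidiag.mp hk).1
      have h2 := hcode hm
      refine hkm (he k m (hle (hk'.trans_le (hsize hm))) (hle (hsize hm)) ?_)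
      change s - code m + code k = s at h
      change code k = code m
      omega
    · intro h
      exact absurd (Finset.mem_piAntidiag.mpr ⟨rfl, fun _ _ => Finset.mem_univ _⟩) h
  have hbound : ∑ t ∈ T, |u t| ≤ A * b ^ D := by
    have hxsum : ∑ i, x i ≤ (n + 1) * b := by
      calc ∑ i, x i ≤ ∑ _i : Fin n, b := Finset.sum_le_sum fun i _ => hxb i
        _ ≤ (n + 1) * b := by simp; linarith
    have hx0 : 0 ≤ ∑ i, x i := Finset.sum_nonneg fun i _ => hx i
    have hA : (A : ℤ) = (∑ m ∈ p.support, |p.coeff m * w m|) * (n + 1) ^ D := by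
      simp only [A, Nat.cast_mul, Nat.cast_pow, Nat.cast_add, Nat.cast_one]
      rw [Int.toNat_of_nonneg (Finset.sum_nonneg fun _ _ => abs_nonneg _)]
    rw [hA, mul_assoc, ← mul_pow, Finset.sum_mul, Finset.sum_sigma]
    refine Finset.sum_le_sum fun m hm => ?_
    calc ∑ k ∈ Finset.piAntidiag Finset.univ (size m), |u ⟨m, k⟩|
        = |p.coeff m * w m| * (∑ i, x i) ^ size m := by
          rw [Finset.sum_pow_eq_sum_piAntidiag, Finset.mul_sum]
          refine Finset.sum_congr rfl fun k _ => ?_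
          simp only [u]
          rw [abs_mul, abs_of_nonneg (a := mult k * _)]
          exact mul_nonneg (hmult k).le (Finset.prod_nonneg fun i _ => pow_nonneg (hx i) _)
      _ ≤ |p.coeff m * w m| * ((n + 1) * b) ^ D := by
          refine mul_le_mul_of_nonneg_left ?_ (abs_nonneg _)
          refine (pow_le_pow_left₀ hx0 hxsum _).trans (pow_le_pow_right₀ ?_ (hsize hm))
          nlinarith [Int.natCast_nonneg n]
  have hL : ∏ m ∈ p.support, mult m ≠ 0 := Finset.prod_ne_zero_iff.mpr fun m _ => (hmult m).ne'
  rw [hg, ← sum_coeff_eq_zero_iff T u pos B s (by linarith), hV, mul_eq_zero,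
    or_iff_right hL]

/-- If a set of nonnegative integers admits a Diophantine representation, then it
is represented by a formula of the form (1). -/
theorem diophantine_set_has_form1_representation (R : Set ℕ) (δ : ℕ) (hδ : 1 ≤ δ)
    (R₀ : MvPolynomial (Fin (δ + 1)) ℤ)
    (hrep : ∀ a : ℕ, a ∈ R ↔ ∃ h : Fin δ → ℕ,
      MvPolynomial.eval (Fin.cons (a : ℤ) (fun ι => (h ι : ℤ))) R₀ = 0) :
    ∃ (ε : ℕ), 0 < ε ∧ ∃ P D Q : Fin ε → MvPolynomial (Fin 3) ℤ,
      ∀ a : ℕ, a ∈ R ↔ ∃ b c : ℕ, ∀ ι : Fin ε, ∃ d : ℕ,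
        MvPolynomial.eval ![(a : ℤ), (b : ℤ), (c : ℤ)] (P ι) <
          MvPolynomial.eval ![(a : ℤ), (b : ℤ), (c : ℤ)] (D ι) * (d : ℤ) ∧
        MvPolynomial.eval ![(a : ℤ), (b : ℤ), (c : ℤ)] (D ι) * (d : ℤ) <
          MvPolynomial.eval ![(a : ℤ), (b : ℤ), (c : ℤ)] (Q ι) := by
  set D := R₀.totalDegree with hD
  set M := D + 2 with hM
  set K := D + 1 with hK
  obtain ⟨g, s, A, hg⟩ := exists_poly_eval_eq_zero_iff R₀ (fun i => M ^ (i : ℕ))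
    fun k l hk hl => eq_of_sum_mul_pow_eq (fun i => by have := hk i; omega)
      fun i => by have := hl i; omega
  let pos (j : ℕ) : ℕ := K * M ^ (j + 1)
  have hpos : StrictMono pos := fun i j hij =>
    Nat.mul_lt_mul_of_pos_left (Nat.pow_lt_pow_right (by omega) (by omega)) (by omega)
  let G : MvPolynomial (Fin 3) ℤ := bind₁ ![X 1 ^ K, X 0 * X 1 ^ K + X 2] g
  have hG (a b c : ℕ) : eval ![(a : ℤ), (b : ℤ), (c : ℤ)] G =
      eval ![(b : ℤ) ^ K, a * (b : ℤ) ^ K + c] g := by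
    have h : (fun i => eval ![(a : ℤ), (b : ℤ), (c : ℤ)]
        ((![X 1 ^ K, X 0 * X 1 ^ K + X 2] : Fin 2 → MvPolynomial (Fin 3) ℤ) i)) =
        ![(b : ℤ) ^ K, a * (b : ℤ) ^ K + c] := by
      funext i
      fin_cases i <;> simp
    rw [← h]
    exact eval₂Hom_bind₁ _ _ _ _
  obtain ⟨ε, hε, P, N, Q, hS⟩ := IsMultipleSystem.exists_fin
    ((IsMultipleSystem.pos (X 1 - X 0 - C (4 * A : ℤ))).and
      (((IsMultipleSystem.mod_pow_lt (pos 0) 0).and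
        ((IsMultipleSystem.forall_lt δ fun j =>
          IsMultipleSystem.mod_pow_lt (pos (j + 1)) (pos j + 1)).and
            (IsMultipleSystem.pos (X 1 ^ pos δ - X 2)))).and
      (IsMultipleSystem.abs_sub_lt G (r := K * (s + 1)) (s := K * s) (by gcongr; omega))))
  refine ⟨ε, hε, P, N, Q, fun a => ?_⟩
  refine Iff.trans ?_ (exists_congr fun b => exists_congr fun c => hS a b c)
  have hlarge (b : ℕ) : (0 : ℤ) < b - a - 4 * A ↔ a + 4 * A < b := by omega
  have hless (b c : ℕ) : 0 < (b : ℤ) ^ pos δ - c ↔ c < b ^ pos δ := by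
    rw [sub_pos]
    norm_cast
  simp only [map_sub, map_pow, eval_X, eval_C, Matrix.cons_val, hlarge, hless, hG]
  have key (b : ℕ) (h : ℕ → ℕ) (hab : a + 4 * A < b) (hh : ∀ j < δ, h j < b) :
      eval (Fin.cons (a : ℤ) (fun i => (h i : ℤ)) : Fin (δ + 1) → ℤ) R₀ = 0 ↔
        ∃ d : ℤ, |2 * eval ![(b : ℤ) ^ K, a * (b : ℤ) ^ K +
          (∑ j ∈ Finset.range δ, h j * b ^ pos j : ℕ)] g - 2 * (b : ℤ) ^ (K * (s + 1)) * d| <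
            (b : ℤ) ^ (K * s) := by
    have hb : (0 : ℤ) < b := by omega
    rw [hg _ b ((b : ℤ) ^ K) hb]
    · rw [Fin.sum_univ_succ]
      simp only [Fin.cons_zero, Fin.cons_succ, Fin.val_zero, Fin.val_succ, pow_zero, pow_one,
        ← pow_mul, Nat.cast_sum, Nat.cast_mul, Nat.cast_pow]
      rw [Finset.sum_range fun j => (h j : ℤ) * (b : ℤ) ^ pos j]
    · exact Fin.cases (by simp) (by simp)
    · refine Fin.cases ?_ fun i => ?_
      · simp only [Fin.cons_zero]
        omega
      · simpa using (hh i i.isLt).le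
    · rw [hK, pow_succ, ← mul_assoc, mul_comm _ (b : ℤ)]
      exact mul_lt_mul_of_pos_right (by omega) (pow_pos hb _)
  rw [hrep]
  constructor
  · rintro ⟨h, hh⟩
    let h' (j : ℕ) : ℕ := if hj : j < δ then h ⟨j, hj⟩ else 0
    have hh' : (fun i : Fin δ => (h' i : ℤ)) = fun i => (h i : ℤ) := by
      funext i
      simp [h']
    let b := a + 4 * A + ∑ i, h i + 1
    have hb : ∀ j < δ, h' j < b := by
      intro j hj
      have := Finset.single_le_sum (f := h) (fun _ _ => Nat.zero_le _) (Finset.mem_univ ⟨j, hj⟩)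
      simp only [h', hj, dif_pos, b]
      omega
    have hab : a + 4 * A < b := by omega
    refine ⟨b, ∑ j ∈ Finset.range δ, h' j * b ^ pos j, hab, ?_, by omega,
      (key b h' hab hb).mp (hh' ▸ hh)⟩
    exact (exists_digits_iff (by omega) hpos).mpr ⟨h', hb, rfl⟩
  · rintro ⟨b, c, hab, hc, hb, hd⟩
    obtain ⟨h, hh, rfl⟩ := (exists_digits_iff hb hpos).mp hc
    exact ⟨fun i => h i, (key b h hab hh).mpr hd⟩
end

section
/- Let R be a set of nonnegative integers admitting a Diophantine representation: there exist δ ≥ 1 and a polynomial R₀ with integer coefficients in δ+1 variables such that for all nonnegative integers a, a ∈ R if and only if there exist nonnegative integers h₁,…,h_δ with R₀(a,h₁,…,h_δ) = 0. Then there exist a polynomial F with integer coefficients in three variables and a polynomial W with integer coefficients in four variables such that for every nonnegative integer a, a ∈ R if and only if there exist nonnegative integers b and c such that for every nonnegative integer f with f ≤ F(a,b,c) one has W(a,b,c,f) > 0. -/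
open MvPolynomial

theorem exists_base_expansion {ι : Type*} (s : Finset ι) (t : ι → ℤ) (e : ι → ℕ) (K : ℕ) {B : ℤ}
    (hB : 0 < B) :
    ∃ H L : ℤ, ∑ i ∈ s, t i * B ^ e i
        = H * B ^ (K + 1) + (∑ i ∈ s with e i = K, t i) * B ^ K + L ∧
      B * |L| ≤ B ^ K * ∑ i ∈ s, |t i| := by
  classical
  induction s using Finset.induction with
  | empty => exact ⟨0, 0, by simp⟩
  | insert j s hj ih =>
    obtain ⟨H, L, hsum, hL⟩ := ih
    rw [Finset.sum_insert hj, Finset.sum_insert hj, Finset.filter_insert, hsum]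
    have hnn : 0 ≤ B ^ K * |t j| := by positivity
    rcases lt_trichotomy (e j) K with h | h | h
    · rw [if_neg h.ne]
      refine ⟨H, L + t j * B ^ e j, by ring, ?_⟩
      have h1 : B * B ^ e j ≤ B ^ K := by
        rw [← pow_succ']
        exact pow_le_pow_right₀ (by omega) h
      have h2 : |L + t j * B ^ e j| ≤ |L| + |t j| * B ^ e j := by
        refine (abs_add_le _ _).trans ?_
        rw [abs_mul, abs_of_pos (pow_pos hB (e j))]
      nlinarith [mul_le_mul_of_nonneg_left h1 (abs_nonneg (t j)),
        mul_le_mul_of_nonneg_left h2 hB.le]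
    · rw [if_pos h, Finset.sum_insert (by simp [hj])]
      refine ⟨H, L, by rw [h]; ring, by rw [mul_add]; linarith⟩
    · rw [if_neg h.ne']
      refine ⟨H + t j * B ^ (e j - (K + 1)), L, ?_, by rw [mul_add]; linarith⟩
      have : B ^ e j = B ^ (e j - (K + 1)) * B ^ (K + 1) := by
        rw [← pow_add]; congr 1; omega
      rw [this]; ring

theorem sum_digit_eq_zero_iff {ι : Type*} (s : Finset ι) (t : ι → ℤ) (e : ι → ℕ) (K : ℕ) {B : ℤ}
    (hB : 2 * ∑ i ∈ s, |t i| < B) :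
    ∑ i ∈ s with e i = K, t i = 0 ↔
      ∃ q : ℤ, |2 * (∑ i ∈ s, t i * B ^ e i - B ^ (K + 1) * q)| < B ^ K := by
  have hnn : 0 ≤ ∑ i ∈ s, |t i| := Finset.sum_nonneg fun i _ => abs_nonneg (t i)
  have hB0 : 0 < B := by linarith
  have hBK : 0 < B ^ K := pow_pos hB0 K
  obtain ⟨H, L, hsum, hL⟩ := exists_base_expansion s t e K hB0
  have hL2 : 2 * |L| < B ^ K := by
    refine lt_of_mul_lt_mul_left ?_ hB0.le
    nlinarith [mul_lt_mul_of_pos_left hB hBK]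
  have hM : |∑ i ∈ s with e i = K, t i| < B := by
    have h1 : |∑ i ∈ s with e i = K, t i| ≤ ∑ i ∈ s, |t i| :=
      (Finset.abs_sum_le_sum_abs _ _).trans
        (Finset.sum_le_sum_of_subset_of_nonneg (Finset.filter_subset _ _)
          fun i _ _ => abs_nonneg (t i))
    linarith
  rw [hsum]
  generalize ∑ i ∈ s with e i = K, t i = M at *
  constructor
  · rintro rfl
    refine ⟨H, ?_⟩
    have : 2 * (H * B ^ (K + 1) + 0 * B ^ K + L - B ^ (K + 1) * H) = 2 * L := by ring
    rwa [this, abs_mul, abs_two]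
  · rintro ⟨q, hq⟩
    have h1 : |((H - q) * B + M) * B ^ K| < 1 * B ^ K := by
      rw [abs_lt] at hq ⊢
      have h2 := abs_le.1 (le_refl |L|)
      have h3 : 2 * (((H - q) * B + M) * B ^ K) =
          2 * (H * B ^ (K + 1) + M * B ^ K + L - B ^ (K + 1) * q) - 2 * L := by ring
      constructor <;> linarith
    rw [abs_mul, abs_of_pos hBK] at h1
    have h2 := Int.abs_lt_one_iff.1 (lt_of_mul_lt_mul_right h1 hBK.le)
    refine Int.eq_zero_of_abs_lt_dvd (m := B) ⟨q - H, by linarith⟩ hM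

theorem sum_mul_pow_injective {n d : ℕ} {u v : Fin n → ℕ} (hu : ∀ i, u i ≤ d) (hv : ∀ i, v i ≤ d)
    (h : ∑ i, u i * (d + 1) ^ (i : ℕ) = ∑ i, v i * (d + 1) ^ (i : ℕ)) : u = v := by
  have := (finFunctionFinEquiv (m := d + 1) (n := n)).injective
    (a₁ := fun i => ⟨u i, Nat.lt_succ_of_le (hu i)⟩)
    (a₂ := fun i => ⟨v i, Nat.lt_succ_of_le (hv i)⟩)
    (Fin.ext (by simpa only [finFunctionFinEquiv_apply] using h))
  funext i
  simpa using congrFun this i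

theorem MvPolynomial.eval_eq_zero_iff_digit {n : ℕ} (p : MvPolynomial (Fin n) ℤ) :
    ∃ (d K N : ℕ) (D : Polynomial ℤ), 0 < d ∧ ∀ (x : Fin n → ℕ) (B : ℤ),
      2 * (N * (1 + ∑ i, (x i : ℤ)) ^ d) < B →
      (eval (fun i => (x i : ℤ)) p = 0 ↔ ∃ q : ℤ,
        |2 * (D.eval B * (1 + ∑ i, x i * B ^ (d + 1) ^ (i : ℕ)) ^ d - B ^ (K + 1) * q)| < B ^ K) := by
  classical
  let d := p.totalDegree + 1
  let w : (Fin n → ℕ) → ℕ := fun u => ∑ i, u i * (d + 1) ^ (i : ℕ)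
  let K := ∑ α ∈ p.support, w α
  let ex : (Fin n →₀ ℕ) → Option (Fin n) → ℕ := fun α o => o.elim (d - ∑ i, α i) α
  let c : (Fin n →₀ ℕ) → ℤ := fun α => p.coeff α * ∏ o, ((ex α o).factorial : ℤ)
  have hexp : ∀ (x : Fin n → ℤ) (B : ℤ), (1 + ∑ i, x i * B ^ (d + 1) ^ (i : ℕ)) ^ d =
      ∑ k ∈ Finset.piAntidiag (Finset.univ : Finset (Option (Fin n))) d,
        Nat.multinomial Finset.univ k * (∏ i, x i ^ k (some i)) * B ^ w (k ∘ some) := by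
    intro x B
    have h1 := Finset.sum_pow_eq_sum_piAntidiag Finset.univ
      (fun o : Option (Fin n) => o.elim (1 : ℤ) fun i => x i * B ^ (d + 1) ^ (i : ℕ)) d
    rw [Fintype.sum_option] at h1
    simp only [Option.elim] at h1
    rw [h1]
    refine Finset.sum_congr rfl fun k _ => ?_
    rw [Fintype.prod_option]
    simp only [one_pow, one_mul, mul_pow, Finset.prod_mul_distrib, mul_assoc, w,
      Function.comp_apply, ← pow_mul, Finset.prod_pow_eq_pow_sum, mul_comm]
  have hdeg : ∀ α ∈ p.support, ∑ i, α i ≤ d := by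
    intro α hα
    have := le_totalDegree hα
    rw [Finsupp.sum_fintype _ _ (by simp)] at this
    exact this.trans (Nat.le_succ _)
  have hexsum : ∀ α ∈ p.support, ∑ o, ex α o = d := by
    intro α hα
    rw [Fintype.sum_option]
    exact Nat.sub_add_cancel (hdeg α hα)
  refine ⟨d, K, (∑ α ∈ p.support, |c α|).toNat,
    ∑ α ∈ p.support, Polynomial.C (c α) * Polynomial.X ^ (K - w α), Nat.succ_pos _,
    fun x B hB => ?_⟩
  set S := p.support ×ˢ Finset.piAntidiag (Finset.univ : Finset (Option (Fin n))) d
  let t : (Fin n →₀ ℕ) × (Option (Fin n) → ℕ) → ℤ := fun z =>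
    c z.1 * (Nat.multinomial Finset.univ z.2 * ∏ i, (x i : ℤ) ^ z.2 (some i))
  let e : (Fin n →₀ ℕ) × (Option (Fin n) → ℕ) → ℕ := fun z => K - w z.1 + w (z.2 ∘ some)
  have hV : (∑ α ∈ p.support, Polynomial.C (c α) * Polynomial.X ^ (K - w α)).eval B *
      (1 + ∑ i, x i * B ^ (d + 1) ^ (i : ℕ)) ^ d = ∑ z ∈ S, t z * B ^ e z := by
    rw [hexp, Polynomial.eval_finsetSum, Finset.sum_mul_sum, Finset.sum_product]
    refine Finset.sum_congr rfl fun α _ => Finset.sum_congr rfl fun k _ => ?_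
    simp only [Polynomial.eval_mul, Polynomial.eval_C, Polynomial.eval_pow, Polynomial.eval_X, t, e,
      pow_add]
    ring
  have hN : ∑ z ∈ S, |t z| = (∑ α ∈ p.support, |c α|) * (1 + ∑ i, (x i : ℤ)) ^ d := by
    have h1 := hexp (fun i => (x i : ℤ)) 1
    simp only [one_pow, mul_one] at h1
    rw [h1, Finset.sum_mul_sum, Finset.sum_product]
    refine Finset.sum_congr rfl fun α _ => Finset.sum_congr rfl fun k _ => ?_
    simp only [t]
    rw [abs_mul, abs_of_nonneg (a := _ * ∏ i, (x i : ℤ) ^ k (some i)) (by positivity)]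
  have hdig : ∑ z ∈ S with e z = K, t z = d.factorial * eval (fun i => (x i : ℤ)) p := by
    rw [Finset.sum_filter, Finset.sum_product, eval_eq', Finset.mul_sum]
    refine Finset.sum_congr rfl fun α hα => ?_
    have hwK : w α ≤ K := Finset.single_le_sum (f := fun α : Fin n →₀ ℕ => w α)
      (fun _ _ => Nat.zero_le _) hα
    rw [Finset.sum_eq_single (ex α)]
    · have h2 : e (α, ex α) = K := Nat.sub_add_cancel hwK
      have h3 := Nat.multinomial_spec Finset.univ (ex α)
      rw [hexsum α hα] at h3
      rw [if_pos h2, ← h3]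
      simp only [t, c, ex, Option.elim]
      push_cast
      ring
    · intro k hk hne
      rw [if_neg]
      intro hek
      apply hne
      rw [Finset.mem_piAntidiag] at hk
      have hk1 : k none + ∑ i, k (some i) = d := by
        rw [← Fintype.sum_option]; exact hk.1
      have hle : ∀ (u : Fin n → ℕ) i, u i ≤ ∑ i, u i := fun u i =>
        Finset.single_le_sum (fun _ _ => Nat.zero_le _) (Finset.mem_univ i)
      have hw : w (k ∘ some) = w α := by
        simp only [e] at hek
        omega
      have hkα : k ∘ some = α := sum_mul_pow_injective
        (fun i => (hle (k ∘ some) i).trans (by simp only [Function.comp_apply]; omega))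
        (fun i => (hle α i).trans (hdeg α hα)) hw
      funext o
      cases o with
      | none =>
        simp only [ex, Option.elim, ← hkα, Function.comp_apply]
        omega
      | some i => exact congrFun hkα i
    · intro hnot
      refine absurd ?_ hnot
      rw [Finset.mem_piAntidiag]
      exact ⟨hexsum α hα, fun _ _ => Finset.mem_univ _⟩
  have hc : 0 ≤ ∑ α ∈ p.support, |c α| := Finset.sum_nonneg fun α _ => abs_nonneg (c α)
  rw [Int.toNat_of_nonneg hc, ← hN] at hB
  rw [hV, ← sum_digit_eq_zero_iff S t e K hB, hdig]
  simp [Nat.factorial_ne_zero]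

/-- `c` has digits at most `b` in base `B` at positions `v 0 < v 1 < ⋯` and zeros elsewhere. -/
theorem digits_iff {B b : ℕ} (hb : b < B) {v : ℕ → ℕ} (hv0 : v 0 = 0) (hv : StrictMono v)
    (n c : ℕ) :
    (c < B ^ v n ∧ ∀ j < n, c % B ^ v (j + 1) < (b + 1) * B ^ v j) ↔
      ∃ h : Fin n → ℕ, (∀ j, h j ≤ b) ∧ c = ∑ j, h j * B ^ v j := by
  have hB : 0 < B := by omega
  have hstep : ∀ j, (b + 1) * B ^ v j ≤ B ^ v (j + 1) := fun j =>
    calc (b + 1) * B ^ v j ≤ B * B ^ v j := Nat.mul_le_mul_right _ hb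
      _ = B ^ (v j + 1) := (pow_succ' _ _).symm
      _ ≤ B ^ v (j + 1) := Nat.pow_le_pow_right hB (hv (Nat.lt_succ_self j))
  induction n generalizing c with
  | zero => simp [hv0]
  | succ n ih =>
    have hpos : 0 < B ^ v n := pow_pos hB _
    have hmod : ∀ y z, ∀ j < n, (y * B ^ v n + z) % B ^ v (j + 1) = z % B ^ v (j + 1) := by
      intro y z j hj
      obtain ⟨k, hk⟩ := pow_dvd_pow B (hv.monotone (Nat.succ_le_of_lt hj))
      rw [Nat.succ_eq_add_one] at hk
      rw [hk, mul_left_comm, Nat.mul_add_mod]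
    constructor
    · rintro ⟨hc, hd⟩
      have hcn := hd n n.lt_succ_self
      rw [Nat.mod_eq_of_lt hc] at hcn
      obtain ⟨h, hh, hsum⟩ := (ih (c % B ^ v n)).1 ⟨Nat.mod_lt _ hpos, fun j hj => by
        have := hd j (by omega)
        rwa [← Nat.div_add_mod' c (B ^ v n), hmod _ _ j hj] at this⟩
      refine ⟨Fin.snoc h (c / B ^ v n), fun j => ?_, ?_⟩
      · refine Fin.lastCases ?_ (fun j => ?_) j
        · rw [Fin.snoc_last]
          exact Nat.le_of_lt_succ (Nat.div_lt_of_lt_mul (by rwa [mul_comm]))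
        · rw [Fin.snoc_castSucc]
          exact hh j
      · rw [Fin.sum_univ_castSucc]
        simp only [Fin.snoc_castSucc, Fin.snoc_last, Fin.val_castSucc, Fin.val_last, ← hsum]
        exact (Nat.mod_add_div' c _).symm
    · rintro ⟨h, hh, hsum⟩
      rw [Fin.sum_univ_castSucc] at hsum
      simp only [Fin.val_castSucc, Fin.val_last] at hsum
      obtain ⟨hlt, hd⟩ := (ih _).2 ⟨fun j => h j.castSucc, fun j => hh _, rfl⟩
      have hcn : c < (b + 1) * B ^ v n := by
        have := Nat.mul_le_mul_right (B ^ v n) (hh (Fin.last n))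
        rw [hsum, add_mul]
        dsimp only at hlt
        omega
      have hc := hcn.trans_le (hstep n)
      refine ⟨hc, fun j hj => ?_⟩
      rcases Nat.lt_succ_iff_lt_or_eq.1 hj with hj | rfl
      · rw [hsum, add_comm, hmod _ _ j hj]
        exact hd j hj
      · rwa [Nat.mod_eq_of_lt hc]

/-- `P` is expressed by the positivity of a polynomial at all integers, where positivity can only
fail on a polynomially bounded interval of nonnegative integers. -/
def HasBoundedPositivityForm (P : ℕ → ℕ → ℕ → Prop) : Prop :=
  ∃ (F : MvPolynomial (Fin 3) ℤ) (W : MvPolynomial (Fin 4) ℤ), ∀ a b c : ℕ,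
    0 ≤ eval ![(a : ℤ), (b : ℤ), (c : ℤ)] F ∧
    (∀ f : ℤ, eval ![(a : ℤ), (b : ℤ), (c : ℤ), f] W ≤ 0 →
      0 ≤ f ∧ f ≤ eval ![(a : ℤ), (b : ℤ), (c : ℤ)] F) ∧
    (P a b c ↔ ∀ f : ℤ, 0 < eval ![(a : ℤ), (b : ℤ), (c : ℤ), f] W)

theorem eval_rename_castSucc (a b c f : ℤ) (p : MvPolynomial (Fin 3) ℤ) :
    eval ![a, b, c, f] (rename Fin.castSucc p) = eval ![a, b, c] p := by
  rw [eval_rename]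
  congr 2
  funext i
  fin_cases i <;> rfl

namespace HasBoundedPositivityForm

theorem congr {P Q : ℕ → ℕ → ℕ → Prop} (hP : HasBoundedPositivityForm P)
    (h : ∀ a b c, P a b c ↔ Q a b c) : HasBoundedPositivityForm Q := by
  have : P = Q := by
    funext a b c
    exact propext (h a b c)
  rwa [← this]

theorem and {P Q : ℕ → ℕ → ℕ → Prop} (hP : HasBoundedPositivityForm P)
    (hQ : HasBoundedPositivityForm Q) :
    HasBoundedPositivityForm fun a b c => P a b c ∧ Q a b c := by
  obtain ⟨F₁, W₁, h₁⟩ := hP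
  obtain ⟨F₂, W₂, h₂⟩ := hQ
  refine ⟨F₁ + F₂ + 1, W₁ * bind₁ ![X 0, X 1, X 2, X 3 - rename Fin.castSucc F₁ - 1] W₂,
    fun a b c => ?_⟩
  obtain ⟨hF₁, hW₁, hP⟩ := h₁ a b c
  obtain ⟨hF₂, hW₂, hQ⟩ := h₂ a b c
  have hshift : ∀ f : ℤ, eval ![(a : ℤ), (b : ℤ), (c : ℤ), f]
      (bind₁ ![X 0, X 1, X 2, X 3 - rename Fin.castSucc F₁ - 1] W₂) =
        eval ![(a : ℤ), (b : ℤ), (c : ℤ), f - eval ![(a : ℤ), (b : ℤ), (c : ℤ)] F₁ - 1] W₂ := by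
    intro f
    rw [← eval_rename_castSucc a b c f F₁, ← coe_aeval_eq_eval, RingHom.coe_coe, aeval_bind₁,
      ← coe_aeval_eq_eval, RingHom.coe_coe]
    congr 2
    funext i
    fin_cases i <;> simp [aeval_eq_eval]
  simp only [map_add, map_mul, map_one, hshift]
  set A := eval ![(a : ℤ), (b : ℤ), (c : ℤ)] F₁
  refine ⟨by omega, fun f hf => ?_, ?_⟩
  · rcases le_or_gt (eval ![(a : ℤ), (b : ℤ), (c : ℤ), f] W₁) 0 with h | h
    · have := hW₁ f h
      omega
    · have := hW₂ (f - A - 1) (nonpos_of_mul_nonpos_right hf h)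
      omega
  · rw [hP, hQ]
    constructor
    · rintro ⟨h, h'⟩ f
      exact mul_pos (h f) (h' _)
    · intro h
      constructor
      · intro f
        by_contra! hf
        have hf' := hW₁ f hf
        have h2 : 0 < eval ![(a : ℤ), (b : ℤ), (c : ℤ), f - A - 1] W₂ := by
          by_contra! h3
          have := hW₂ _ h3
          omega
        exact absurd (h f) (not_lt.2 (mul_nonpos_of_nonpos_of_nonneg hf h2.le))
      · intro f
        by_contra! hf
        have hf' := hW₂ f hf
        have h2 : 0 < eval ![(a : ℤ), (b : ℤ), (c : ℤ), f + A + 1] W₁ := by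
          by_contra! h3
          have := hW₁ _ h3
          omega
        have h4 := h (f + A + 1)
        rw [show f + A + 1 - A - 1 = f by ring] at h4
        exact absurd h4 (not_lt.2 (mul_nonpos_of_nonneg_of_nonpos h2.le hf))

theorem pos (p : MvPolynomial (Fin 3) ℤ) :
    HasBoundedPositivityForm fun a b c => 0 < eval ![(a : ℤ), (b : ℤ), (c : ℤ)] p := by
  refine ⟨0, rename Fin.castSucc p + X 3 ^ 2 * (rename Fin.castSucc p ^ 2 + 1), fun a b c => ?_⟩
  simp only [map_add, map_mul, map_pow, map_one, map_zero, eval_rename_castSucc, eval_X]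
  generalize eval ![(a : ℤ), (b : ℤ), (c : ℤ)] p = y
  have key : ∀ f : ℤ, f ≠ 0 → 0 < y + f ^ 2 * (y ^ 2 + 1) := by
    intro f hf
    have : 0 < f ^ 2 := by positivity
    nlinarith [mul_nonneg (show 0 ≤ f ^ 2 - 1 by omega) (show 0 ≤ y ^ 2 + 1 by positivity)]
  refine ⟨le_rfl, fun f hf => ?_, fun h f => ?_, fun h => ?_⟩
  · have : f = 0 := by
      by_contra h
      exact absurd (key f h) (not_lt.2 hf)
    omega
  · change 0 < y + f ^ 2 * (y ^ 2 + 1)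
    positivity
  · simpa using h 0

theorem forall_lt {P : ℕ → ℕ → ℕ → ℕ → Prop} (h : ∀ j, HasBoundedPositivityForm (P j)) (n : ℕ) :
    HasBoundedPositivityForm fun a b c => ∀ j < n, P j a b c := by
  induction n with
  | zero => exact (pos 1).congr fun a b c => by simp
  | succ n ih => exact (ih.and (h n)).congr fun a b c => Nat.forall_lt_succ_right.symm

theorem residue {U m r : MvPolynomial (Fin 3) ℤ}
    (hU : ∀ a b c : ℕ, 0 < eval ![(a : ℤ), (b : ℤ), (c : ℤ)] U)
    (hr : ∀ a b c : ℕ, 0 < eval ![(a : ℤ), (b : ℤ), (c : ℤ)] r)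
    (hm : ∀ a b c : ℕ, eval ![(a : ℤ), (b : ℤ), (c : ℤ)] r ≤ eval ![(a : ℤ), (b : ℤ), (c : ℤ)] m) :
    HasBoundedPositivityForm fun a b c => ∃ q : ℤ,
      0 < eval ![(a : ℤ), (b : ℤ), (c : ℤ)] U - eval ![(a : ℤ), (b : ℤ), (c : ℤ)] m * q ∧
      eval ![(a : ℤ), (b : ℤ), (c : ℤ)] U - eval ![(a : ℤ), (b : ℤ), (c : ℤ)] m * q
        < eval ![(a : ℤ), (b : ℤ), (c : ℤ)] r := by
  refine ⟨U, (rename Fin.castSucc U - rename Fin.castSucc m * X 3 - rename Fin.castSucc r) *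
    (rename Fin.castSucc U - rename Fin.castSucc m * X 3 - rename Fin.castSucc m),
    fun a b c => ?_⟩
  replace hU := hU a b c
  replace hr := hr a b c
  replace hm := hm a b c
  simp only [map_sub, map_mul, eval_rename_castSucc, eval_X]
  generalize eval ![(a : ℤ), (b : ℤ), (c : ℤ)] U = u at *
  generalize eval ![(a : ℤ), (b : ℤ), (c : ℤ)] m = m at *
  generalize eval ![(a : ℤ), (b : ℤ), (c : ℤ)] r = r at *
  change 0 ≤ u ∧ (∀ f : ℤ, (u - m * f - r) * (u - m * f - m) ≤ 0 → 0 ≤ f ∧ f ≤ u) ∧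
    (_ ↔ ∀ f : ℤ, 0 < (u - m * f - r) * (u - m * f - m))
  have hm0 : 0 < m := by omega
  refine ⟨hU.le, fun f hf => ?_, ?_, fun h => ?_⟩
  · have h1 : u - m * f - m ≤ 0 := by
      by_contra! h
      exact absurd (mul_pos (show 0 < u - m * f - r by omega) h) (not_lt.2 hf)
    have h2 : 0 ≤ u - m * f - r := by
      by_contra! h
      exact absurd (mul_pos_of_neg_of_neg h (show u - m * f - m < 0 by omega)) (not_lt.2 hf)
    constructor <;> by_contra! h <;> nlinarith
  · rintro ⟨q, h1, h2⟩ f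
    rcases lt_or_ge f q with h | h
    · have : m * (f + 1) ≤ m * q := mul_le_mul_of_nonneg_left h hm0.le
      rw [mul_add] at this
      exact mul_pos (by omega) (by omega)
    · have : m * q ≤ m * f := mul_le_mul_of_nonneg_left h hm0.le
      exact mul_pos_of_neg_of_neg (by omega) (by omega)
  · have h1 := Int.mul_ediv_add_emod u m
    have h2 := Int.emod_nonneg u hm0.ne'
    have h3 := Int.emod_lt_of_pos u hm0
    refine ⟨u / m, ?_, ?_⟩
    · by_contra! h4
      have h5 := h (u / m - 1)
      rw [show u - m * (u / m - 1) - m = 0 by rw [mul_sub]; omega, mul_zero] at h5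
      exact lt_irrefl _ h5
    · by_contra! h4
      exact absurd (h (u / m)) (not_lt.2 (mul_nonpos_of_nonneg_of_nonpos (by omega) (by omega)))

end HasBoundedPositivityForm

theorem Nat.mod_lt_iff_exists_int {c m r : ℕ} (hr : r ≤ m) :
    c % m < r ↔ ∃ q : ℤ, 0 < 2 * (c : ℤ) + 1 - 2 * m * q ∧ 2 * (c : ℤ) + 1 - 2 * m * q < 2 * r := by
  constructor
  · intro h
    refine ⟨(c / m : ℕ), ?_⟩
    have h1 : (m : ℤ) * (c / m : ℕ) + (c % m : ℕ) = c := mod_cast Nat.div_add_mod c m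
    rw [mul_assoc]
    omega
  · rintro ⟨q, h1, h2⟩
    rw [mul_assoc] at h1 h2
    have h3 := ((Int.ediv_emod_unique (a := (c : ℤ)) (b := (m : ℤ)) (r := c - m * q) (q := q)
      (by omega)).2 ⟨by ring, by omega, by omega⟩).2
    omega

theorem abs_two_mul_sub_lt_iff (V M T : ℤ) :
    (∃ q : ℤ, |2 * (V - M * q)| < T) ↔
      ∃ q : ℤ, 0 < 2 * V + T + 2 * M * (V ^ 2 + 1) - 2 * M * q ∧
        2 * V + T + 2 * M * (V ^ 2 + 1) - 2 * M * q < 2 * T := by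
  simp only [abs_lt]
  constructor
  · rintro ⟨q, h1, h2⟩
    exact ⟨q + (V ^ 2 + 1), by linarith, by linarith⟩
  · rintro ⟨q, h1, h2⟩
    exact ⟨q - (V ^ 2 + 1), by linarith, by linarith⟩

/-- The base `2 * N * (1 + a + δ * b) ^ d + b + 2`. -/
noncomputable def codingBase (N δ d : ℕ) : MvPolynomial (Fin 3) ℤ :=
  2 * ((N : MvPolynomial (Fin 3) ℤ) *
    (1 + X 0 + (δ : MvPolynomial (Fin 3) ℤ) * X 1) ^ d) + X 1 + 2

theorem eval_codingBase (N δ d a b c : ℕ) :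
    eval ![(a : ℤ), (b : ℤ), (c : ℤ)] (codingBase N δ d) =
      (2 * (N * (1 + a + δ * b) ^ d) + b + 2 : ℕ) := by
  simp [codingBase]

theorem HasBoundedPositivityForm.digits (N δ d : ℕ) {v : ℕ → ℕ} (hv : StrictMono v) :
    HasBoundedPositivityForm fun a b c =>
      c < (2 * (N * (1 + a + δ * b) ^ d) + b + 2) ^ v δ ∧
      ∀ j < δ, c % (2 * (N * (1 + a + δ * b) ^ d) + b + 2) ^ v (j + 1) <
        (b + 1) * (2 * (N * (1 + a + δ * b) ^ d) + b + 2) ^ v j := by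
  have hle : ∀ a b j : ℕ, (b + 1) * (2 * (N * (1 + a + δ * b) ^ d) + b + 2) ^ v j ≤
      (2 * (N * (1 + a + δ * b) ^ d) + b + 2) ^ v (j + 1) := by
    intro a b j
    calc _ ≤ (2 * (N * (1 + a + δ * b) ^ d) + b + 2) ^ (v j + 1) := by
          rw [pow_succ']
          exact Nat.mul_le_mul_right _ (by omega)
      _ ≤ _ := Nat.pow_le_pow_right (by omega) (hv (Nat.lt_succ_self j))
  refine ((pos (codingBase N δ d ^ v δ - X 2)).congr fun a b c => ?_).and
    (forall_lt (fun j => (residue (U := 2 * X 2 + 1) (m := 2 * codingBase N δ d ^ v (j + 1))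
      (r := 2 * ((X 1 + 1) * codingBase N δ d ^ v j)) (fun a b c => ?_) (fun a b c => ?_)
      fun a b c => ?_).congr fun a b c => ?_) δ)
  · rw [map_sub, map_pow, eval_codingBase, eval_X, sub_pos, ← Nat.cast_pow]
    exact Nat.cast_lt
  · simp only [map_add, map_mul, map_one, map_ofNat, eval_X]
    change (0 : ℤ) < 2 * c + 1
    positivity
  · simp only [map_add, map_mul, map_one, map_ofNat, map_pow, eval_X, eval_codingBase]
    change (0 : ℤ) < 2 * ((b + 1) * _)
    positivity
  · simp only [map_add, map_mul, map_one, map_ofNat, map_pow, eval_X, eval_codingBase]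
    change (2 : ℤ) * ((b + 1) * _) ≤ _
    have := hle a b j
    zify at this
    push_cast
    linarith
  · rw [Nat.mod_lt_iff_exists_int (hle a b j)]
    simp only [map_add, map_mul, map_one, map_ofNat, map_pow, eval_X, eval_codingBase]
    push_cast
    rfl

theorem HasBoundedPositivityForm.digit_eq_zero (N δ d K : ℕ)
    (V : MvPolynomial (Fin 3) ℤ) :
    HasBoundedPositivityForm fun a b c => ∃ q : ℤ,
      |2 * (eval ![(a : ℤ), (b : ℤ), (c : ℤ)] V -
        ((2 * (N * (1 + a + δ * b) ^ d) + b + 2 : ℕ) : ℤ) ^ (K + 1) * q)| <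
        ((2 * (N * (1 + a + δ * b) ^ d) + b + 2 : ℕ) : ℤ) ^ K := by
  refine (residue (U := 2 * V + codingBase N δ d ^ K +
      2 * codingBase N δ d ^ (K + 1) * (V ^ 2 + 1)) (m := 2 * codingBase N δ d ^ (K + 1))
    (r := 2 * codingBase N δ d ^ K) (fun a b c => ?_) (fun a b c => ?_) fun a b c => ?_).congr
      fun a b c => ?_
  all_goals
    simp only [map_add, map_mul, map_one, map_ofNat, map_pow, eval_codingBase]
  · have h : (0 : ℤ) < ((2 * (N * (1 + a + δ * b) ^ d) + b + 2 : ℕ) : ℤ) := by positivity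
    have h1 := pow_pos h (K + 1)
    have h2 := pow_pos h K
    generalize eval ![(a : ℤ), (b : ℤ), (c : ℤ)] V = y
    nlinarith [mul_nonneg (Int.le_sub_one_of_lt h1) (add_nonneg (sq_nonneg y) zero_le_one),
      sq_nonneg (y + 1), sq_nonneg y]
  · positivity
  · have h : (1 : ℤ) ≤ ((2 * (N * (1 + a + δ * b) ^ d) + b + 2 : ℕ) : ℤ) := by
      norm_cast
      omega
    exact mul_le_mul_of_nonneg_left (pow_le_pow_right₀ h (Nat.le_succ K)) zero_le_two
  · exact (abs_two_mul_sub_lt_iff _ _ _).symm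


/-- If a set of nonnegative integers admits a Diophantine representation, then it
is represented by a formula of the form (2). -/
theorem diophantine_set_has_form2_representation (R : Set ℕ) (δ : ℕ) (hδ : 1 ≤ δ)
    (R₀ : MvPolynomial (Fin (δ + 1)) ℤ)
    (hrep : ∀ a : ℕ, a ∈ R ↔ ∃ h : Fin δ → ℕ,
      MvPolynomial.eval (Fin.cons (a : ℤ) (fun ι => (h ι : ℤ))) R₀ = 0) :
    ∃ (F : MvPolynomial (Fin 3) ℤ) (W : MvPolynomial (Fin 4) ℤ),
      ∀ a : ℕ, a ∈ R ↔ ∃ b c : ℕ, ∀ f : ℕ,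
        (f : ℤ) ≤ MvPolynomial.eval ![(a : ℤ), (b : ℤ), (c : ℤ)] F →
        0 < MvPolynomial.eval ![(a : ℤ), (b : ℤ), (c : ℤ), (f : ℤ)] W := by
  obtain ⟨d, K, N, D, hd, hD⟩ := MvPolynomial.eval_eq_zero_iff_digit R₀
  let v : ℕ → ℕ := fun j => (d + 1) ^ (j + 1) - (d + 1)
  have hvadd : ∀ j, (d + 1) + v j = (d + 1) ^ (j + 1) := fun j =>
    Nat.add_sub_cancel' (Nat.le_self_pow (Nat.succ_ne_zero j) _)
  have hv0 : v 0 = 0 := by simp [v]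
  have hv : StrictMono v := strictMono_nat_of_lt_succ fun j => by
    have h1 := hvadd j
    have h2 := hvadd (j + 1)
    have h3 : (d + 1) ^ (j + 1) < (d + 1) ^ (j + 1 + 1) :=
      Nat.pow_lt_pow_right (by omega) (Nat.lt_succ_self _)
    omega
  let V : MvPolynomial (Fin 3) ℤ := Polynomial.aeval (codingBase N δ d) D *
    (1 + X 0 * codingBase N δ d + codingBase N δ d ^ (d + 1) * X 2) ^ d
  obtain ⟨F, W, hFW⟩ := (HasBoundedPositivityForm.digits N δ d hv).and
    (HasBoundedPositivityForm.digit_eq_zero N δ d K V)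
  have hR : ∀ a, a ∈ R ↔ ∃ b c : ℕ,
      ∀ f : ℤ, 0 < eval ![(a : ℤ), (b : ℤ), (c : ℤ), f] W := by
    intro a
    have hcode : ∀ (b c : ℕ) (h : Fin δ → ℕ), (∀ j, h j ≤ b) →
        c = ∑ j, h j * (2 * (N * (1 + a + δ * b) ^ d) + b + 2) ^ v j →
        (eval (Fin.cons (a : ℤ) (fun ι => (h ι : ℤ))) R₀ = 0 ↔ ∃ q : ℤ,
          |2 * (eval ![(a : ℤ), (b : ℤ), (c : ℤ)] V -
            ((2 * (N * (1 + a + δ * b) ^ d) + b + 2 : ℕ) : ℤ) ^ (K + 1) * q)| <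
            ((2 * (N * (1 + a + δ * b) ^ d) + b + 2 : ℕ) : ℤ) ^ K) := by
      intro b c h hb hc
      have hx : (Fin.cons (a : ℤ) (fun ι => (h ι : ℤ)) : Fin (δ + 1) → ℤ) =
          fun i => ((Fin.cons a h : Fin (δ + 1) → ℕ) i : ℤ) := by
        funext i
        refine Fin.cases rfl (fun _ => rfl) i
      have hsum : ∑ j, h j ≤ δ * b := by
        simpa using Finset.sum_le_card_nsmul Finset.univ h b fun j _ => hb j
      rw [hx, hD _ ((2 * (N * (1 + a + δ * b) ^ d) + b + 2 : ℕ) : ℤ)]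
      · have hV : eval ![(a : ℤ), (b : ℤ), (c : ℤ)] V =
            D.eval ((2 * (N * (1 + a + δ * b) ^ d) + b + 2 : ℕ) : ℤ) *
              (1 + a * ((2 * (N * (1 + a + δ * b) ^ d) + b + 2 : ℕ) : ℤ) +
                ((2 * (N * (1 + a + δ * b) ^ d) + b + 2 : ℕ) : ℤ) ^ (d + 1) * c) ^ d := by
          simp only [V, map_add, map_mul, map_one, map_pow, eval_X, eval_codingBase,
            Polynomial.aeval_def, Polynomial.hom_eval₂]
          rw [← Polynomial.eval₂_id (R := ℤ)]
          congr 2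
          exact RingHom.ext_int _ _
        rw [hV, hc]
        generalize 2 * (N * (1 + a + δ * b) ^ d) + b + 2 = B
        have hC : (1 : ℤ) + ∑ i, ((Fin.cons a h : Fin (δ + 1) → ℕ) i : ℤ) *
            (B : ℤ) ^ (d + 1) ^ (i : ℕ) =
              1 + a * (B : ℤ) + (B : ℤ) ^ (d + 1) * (∑ j, h j * B ^ v j : ℕ) := by
          rw [Fin.sum_univ_succ]
          push_cast
          rw [Finset.mul_sum, ← add_assoc]
          congr 1
          · simp
          · refine Finset.sum_congr rfl fun j _ => ?_
            rw [Fin.cons_succ, Fin.val_succ, ← hvadd, pow_add _ (d + 1)]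
            ring
        rw [hC]
      · rw [Fin.sum_univ_succ]
        simp only [Fin.cons_zero, Fin.cons_succ]
        norm_cast
        have : (1 + (a + ∑ j, h j)) ^ d ≤ (1 + a + δ * b) ^ d :=
          Nat.pow_le_pow_left (by omega) d
        have := Nat.mul_le_mul_left N this
        omega
    rw [hrep]
    simp only [← (hFW a _ _).2.2]
    constructor
    · rintro ⟨h, h0⟩
      refine ⟨∑ j, h j, _, (digits_iff (by omega) hv0 hv δ _).2 ⟨h, fun j => ?_, rfl⟩,
        (hcode _ _ h (fun j => ?_) rfl).1 h0⟩
      all_goals exact Finset.single_le_sum (fun _ _ => Nat.zero_le _) (Finset.mem_univ j)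
    · rintro ⟨b, c, hdig, hq⟩
      obtain ⟨h, hb, hc⟩ := (digits_iff (by omega) hv0 hv δ c).1 hdig
      exact ⟨h, (hcode b c h hb hc).2 hq⟩
  refine ⟨F, W, fun a => (hR a).trans (exists_congr fun b => exists_congr fun c => ?_)⟩
  obtain ⟨-, hbd, -⟩ := hFW a b c
  refine ⟨fun h f _ => h f, fun h f => ?_⟩
  by_contra! hf
  obtain ⟨h0, h1⟩ := hbd f hf
  lift f to ℕ using h0
  exact absurd (h f h1) (not_lt.2 hf)
end
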